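/- arXiv:1807.08336 — 12 statements merged into one kernel-verified Lean document; each statement's English description precedes it below -/
import Mathlib

section
/- Let P be an n×n real symmetric idempotent matrix (P' = P and P² = P), let z ∈ ℝⁿ with ‖z‖ = 1 and Pz = 0, and let g > 0 and σ > 0. Then for every y ∈ ℝⁿ: det(σ²(Iₙ + gP + g z z'))^{-1/2} · exp(−y'(σ²(Iₙ + gP + g z z'))⁻¹ y / 2) = det(σ²(Iₙ + gP))^{-1/2} · exp(−y'(σ²(Iₙ + gP))⁻¹ y / 2) · (1+g)^{-1/2} · exp( g (y'z)² / (2σ²(1+g)) ). -/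
open Matrix

namespace Matrix

variable {ι K : Type*} [Fintype ι] [DecidableEq ι]

theorem inv_smul_one_add_smul_of_isIdempotentElem [Field K] {Q : Matrix ι ι K}
    (hQ : IsIdempotentElem Q) {c g : K} (hc : c ≠ 0) (hg : 1 + g ≠ 0) :
    (c • (1 + g • Q))⁻¹ = c⁻¹ • (1 - (g / (1 + g)) • Q) := by
  apply inv_eq_right_inv
  have hcoeff : g - g / (1 + g) - g * (g / (1 + g)) = 0 := by
    field_simp
    ring
  calc
    c • (1 + g • Q) * c⁻¹ • (1 - (g / (1 + g)) • Q)
        = (1 + g • Q) * (1 - (g / (1 + g)) • Q) := by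
          rw [smul_mul_smul_comm, mul_inv_cancel₀ hc, one_smul]
    _ = 1 + (g - g / (1 + g) - g * (g / (1 + g))) • Q := by
          simp only [add_mul, mul_sub, one_mul, mul_one, smul_mul_smul_comm, hQ.eq]
          module
    _ = 1 := by rw [hcoeff, zero_smul, add_zero]

theorem det_one_add_vecMulVec [CommRing K] (u v : ι → K) :
    (1 + vecMulVec u v).det = 1 + v ⬝ᵥ u := by
  rw [vecMulVec_eq Unit, det_one_add_replicateCol_mul_replicateRow]

theorem det_smul_one_add_smul_add_smul_vecMulVec [CommRing K] {P : Matrix ι ι K} {z : ι → K}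
    (hz : z ⬝ᵥ z = 1) (hPz : P *ᵥ z = 0) (c g : K) :
    (c • (1 + g • P + g • vecMulVec z z)).det = (c • (1 + g • P)).det * (1 + g) := by
  have hfactor : c • (1 + g • P + g • vecMulVec z z) =
      c • (1 + g • P) * (1 + vecMulVec (g • z) z) := by
    rw [smul_mul_assoc, mul_add, mul_one, mul_vecMulVec, add_mulVec, one_mulVec, smul_mulVec,
      mulVec_smul, hPz, smul_zero, smul_zero, add_zero, smul_vecMulVec]
  rw [hfactor, det_mul, det_one_add_vecMulVec, dotProduct_smul, hz, smul_eq_mul, mul_one]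

theorem isIdempotentElem_add_vecMulVec [CommRing K] {P : Matrix ι ι K} {z : ι → K}
    (hPsymm : Pᵀ = P) (hP : IsIdempotentElem P) (hz : z ⬝ᵥ z = 1) (hPz : P *ᵥ z = 0) :
    IsIdempotentElem (P + vecMulVec z z) := by
  have hzP : z ᵥ* P = 0 := by rw [← mulVec_transpose, hPsymm, hPz]
  rw [IsIdempotentElem, add_mul, mul_add, mul_add, hP.eq, mul_vecMulVec, hPz, vecMulVec_mul, hzP,
    vecMulVec_mul_vecMulVec, hz]
  simp

end Matrix

/-- factorization of the Gaussian marginal likelihood under a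
`g`-prior when one additional unit direction `z` orthogonal to the range of
the projection `P` is added. -/
theorem stmt_1 (n : ℕ) (P : Matrix (Fin n) (Fin n) ℝ)
    (hPsymm : Pᵀ = P) (hPidem : P * P = P)
    (z : Fin n → ℝ) (hz : z ⬝ᵥ z = 1) (hPz : P *ᵥ z = 0)
    (g σ : ℝ) (hg : 0 < g) (hσ : 0 < σ) (y : Fin n → ℝ) :
    (Real.sqrt ((σ ^ 2 • ((1 : Matrix (Fin n) (Fin n) ℝ) + g • P + g • vecMulVec z z)).det))⁻¹ *
      Real.exp (-(y ⬝ᵥ ((σ ^ 2 • ((1 : Matrix (Fin n) (Fin n) ℝ) + g • P + g • vecMulVec z z))⁻¹ *ᵥ y)) / 2) =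
    (Real.sqrt ((σ ^ 2 • ((1 : Matrix (Fin n) (Fin n) ℝ) + g • P)).det))⁻¹ *
      Real.exp (-(y ⬝ᵥ ((σ ^ 2 • ((1 : Matrix (Fin n) (Fin n) ℝ) + g • P))⁻¹ *ᵥ y)) / 2) *
    ((Real.sqrt (1 + g))⁻¹ *
      Real.exp (g * (y ⬝ᵥ z) ^ 2 / (2 * σ ^ 2 * (1 + g)))) := by
  have hg1 : 1 + g ≠ 0 := by positivity
  have hσ2 : σ ^ 2 ≠ 0 := by positivity
  have hquad : -(y ⬝ᵥ ((σ ^ 2 • (1 + g • P + g • vecMulVec z z))⁻¹ *ᵥ y)) / 2 =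
      -(y ⬝ᵥ ((σ ^ 2 • (1 + g • P))⁻¹ *ᵥ y)) / 2 +
        g * (y ⬝ᵥ z) ^ 2 / (2 * σ ^ 2 * (1 + g)) := by
    rw [add_assoc, ← smul_add,
      inv_smul_one_add_smul_of_isIdempotentElem
        (isIdempotentElem_add_vecMulVec hPsymm hPidem hz hPz) hσ2 hg1,
      inv_smul_one_add_smul_of_isIdempotentElem hPidem hσ2 hg1]
    simp only [smul_mulVec, sub_mulVec, add_mulVec, one_mulVec, vecMulVec_mulVec,
      dotProduct_smul, dotProduct_sub, dotProduct_add, smul_eq_mul, op_smul_eq_smul,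
      dotProduct_comm z y]
    field_simp
    ring
  rw [hquad, Real.exp_add, det_smul_one_add_smul_add_smul_vecMulVec hz hPz,
    Real.sqrt_mul' _ (by positivity), mul_inv]
  ring
end

section
/- Let p ≥ 1 and k ≥ 1 be integers, g > 0, z₁, …, z_p ∈ ℝ and z ∈ ℝ. Let π be a probability mass function on {0,1}^p × {0,1}^k, writing elements as γ = (γ₁, γ₂). Define p_i = Σ_{γ : γ₁ᵢ = 1} π(γ) for i = 1, …, p, and q = Σ_{γ : γ₂ ≠ 0} π(γ). Define, for γ = (γ₁, γ₂) ∈ {0,1}^p × {0,1}^k, R(γ) = (g/(1+g))² [ Σ_{i=1}^p z_i² (γ₁ᵢ − p_i)² + z² ( (1−q)²·𝟙{γ₂ ≠ 0} + q²·𝟙{γ₂ = 0} ) ]. Then any γ° = (γ₁°, γ₂°) such that γ₁ᵢ° = 1 if and only if p_i > 1/2, and γ₂° ≠ 0 if and only if q > 1/2, minimizes R over {0,1}^p × {0,1}^k. -/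
/-- in the design of `p` orthonormal columns plus `k` exact
copies of an extra column, the predictive risk `R` is minimized by any model
including variable `i` iff `p_i > 1/2` and including at least one duplicate
iff `q > 1/2`. -/
theorem stmt_4 (p k : ℕ) (hp : 1 ≤ p) (hk : 1 ≤ k)
    (g : ℝ) (hg : 0 < g) (z : Fin p → ℝ) (z0 : ℝ)
    (π : ((Fin p → Bool) × (Fin k → Bool)) → ℝ)
    (hπ0 : ∀ γ, 0 ≤ π γ) (hπ1 : ∑ γ, π γ = 1)
    (pmarg : Fin p → ℝ)
    (hpmarg : ∀ i, pmarg i =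
      ∑ γ ∈ Finset.univ.filter (fun γ : (Fin p → Bool) × (Fin k → Bool) => γ.1 i = true), π γ)
    (q : ℝ)
    (hq : q = ∑ γ ∈ Finset.univ.filter
      (fun γ : (Fin p → Bool) × (Fin k → Bool) => γ.2 ≠ fun _ => false), π γ)
    (R : ((Fin p → Bool) × (Fin k → Bool)) → ℝ)
    (hR : ∀ γ, R γ = (g / (1 + g)) ^ 2 *
      ((∑ i, (z i) ^ 2 * ((if γ.1 i then (1 : ℝ) else 0) - pmarg i) ^ 2) +
        z0 ^ 2 * (if γ.2 ≠ fun _ => false then (1 - q) ^ 2 else q ^ 2)))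
    (γo : (Fin p → Bool) × (Fin k → Bool))
    (hγo1 : ∀ i, γo.1 i = true ↔ 1 / 2 < pmarg i)
    (hγo2 : (γo.2 ≠ fun _ => false) ↔ 1 / 2 < q) :
    ∀ γ, R γo ≤ R γ := by
  intro γ
  rw [hR, hR]
  refine mul_le_mul_of_nonneg_left (add_le_add (Finset.sum_le_sum fun i _ => ?_) ?_) (sq_nonneg _)
  · refine mul_le_mul_of_nonneg_left ?_ (sq_nonneg _)
    simp only [hγo1 i]
    split_ifs <;> nlinarith
  · refine mul_le_mul_of_nonneg_left ?_ (sq_nonneg _)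
    by_cases h : 1 / 2 < q
    · rw [if_pos (hγo2.mpr h)]
      split_ifs <;> nlinarith
    · rw [if_neg (mt hγo2.mp h)]
      split_ifs <;> nlinarith
end

section
/- Let a ≥ 1, b ≥ 1 and i ≥ 0 be fixed integers and set d = b − 1. Then there exist a constant C > 0 and an integer p₀ such that for all integers p ≥ p₀ and all integers k ≥ 0: | ∏_{j=1}^{i+a} ( (p + d + k − i + j) / (p + d − i + j) ) · ( p/(p+k) )^{i+a} − 1 | ≤ C/p. -/
/-- A finite product of quantities that are `1 + O(1/p)` uniformly in a parameter is again
`1 + O(1/p)` uniformly in that parameter. -/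
theorem exists_abs_prod_sub_one_le_div {ι κ : Type*} (s : Finset ι) (f : ι → ℕ → κ → ℝ)
    (hf : ∀ j ∈ s, ∃ C : ℝ, 0 < C ∧ ∃ p₀ : ℕ, ∀ p : ℕ, p₀ ≤ p → ∀ k, |f j p k - 1| ≤ C / p) :
    ∃ C : ℝ, 0 < C ∧ ∃ p₀ : ℕ, ∀ p : ℕ, p₀ ≤ p → ∀ k, |∏ j ∈ s, f j p k - 1| ≤ C / p := by
  classical
  induction s using Finset.induction_on with
  | empty => exact ⟨1, one_pos, 0, fun p _ k => by simp⟩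
  | insert j s hj ih =>
    obtain ⟨C, hC, p₁, h₁⟩ := hf j (Finset.mem_insert_self j s)
    obtain ⟨D, hD, p₂, h₂⟩ := ih fun l hl => hf l (Finset.mem_insert_of_mem hl)
    refine ⟨C * D + C + D, by positivity, max 1 (max p₁ p₂), fun p hp k => ?_⟩
    simp only [max_le_iff] at hp
    have hp1 : (1 : ℝ) ≤ p := by exact_mod_cast hp.1
    have hx := h₁ p hp.2.1 k
    have hy := h₂ p hp.2.2 k
    rw [Finset.prod_insert hj]
    set x := f j p k
    set y := ∏ l ∈ s, f l p k
    calc |x * y - 1| = |(x - 1) * (y - 1) + (x - 1) + (y - 1)| := by ring_nf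
      _ ≤ |x - 1| * |y - 1| + |x - 1| + |y - 1| := by
        rw [← abs_mul]
        exact abs_add_three _ _ _
      _ ≤ C / p * (D / 1) + C / p + D / p := by
        have hDp : D / p ≤ D / 1 := by gcongr
        gcongr
        exact hy.trans hDp
      _ = (C * D + C + D) / p := by ring

/-- `(p + c + k) / (p + c) = (1 + k / p) (1 + O(1/p))`, uniformly over `k ≥ 0`. -/
theorem exists_abs_shifted_ratio_sub_one_le_div (c : ℝ) :
    ∃ C : ℝ, 0 < C ∧ ∃ p₀ : ℕ, ∀ p : ℕ, p₀ ≤ p → ∀ k : ℕ,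
      |(p + c + k) / (p + c) * (p / (p + k)) - 1| ≤ C / p := by
  obtain ⟨n, hn⟩ := exists_nat_ge (2 * |c|)
  refine ⟨2 * |c| + 1, by positivity, n + 1, fun p hp k => ?_⟩
  have hpn : (n : ℝ) + 1 ≤ p := by exact_mod_cast hp
  have hc := neg_abs_le c
  have hc0 := abs_nonneg c
  have hp0 : (0 : ℝ) < p := by linarith
  have hpc : (p : ℝ) / 2 ≤ p + c := by linarith
  have hpc0 : (0 : ℝ) < p + c := by linarith
  have hk : (0 : ℝ) ≤ k := k.cast_nonneg
  have hpk : (0 : ℝ) < p + k := by linarith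
  have key : (p + c + k) / (p + c) * (p / (p + k)) - 1 = -(c / (p + c) * (k / (p + k))) := by
    field_simp
    ring
  rw [key, abs_neg, abs_mul, abs_div, abs_of_pos hpc0, abs_of_nonneg (div_nonneg hk hpk.le)]
  calc |c| / (p + c) * (k / (p + k)) ≤ |c| / (p / 2) * 1 := by
        gcongr
        rw [div_le_one hpk]
        linarith
    _ = 2 * |c| / p := by ring
    _ ≤ (2 * |c| + 1) / p := by gcongr; linarith

/-- first-order asymptotics of the beta-binomial prior odds:
`∏_{j=1}^{i+a} (p+d+k−i+j)/(p+d−i+j) = (1+k/p)^{i+a} (1 + O(1/p))`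
uniformly over `k ≥ 0`. -/
theorem stmt_7 (a b i : ℕ) (ha : 1 ≤ a) (hb : 1 ≤ b) (d : ℕ) (hd : d = b - 1) :
    ∃ C : ℝ, 0 < C ∧ ∃ p₀ : ℕ, ∀ p : ℕ, p₀ ≤ p → ∀ k : ℕ,
      |(∏ j ∈ Finset.Icc 1 (i + a),
          (((p : ℝ) + d + k - i + j) / ((p : ℝ) + d - i + j))) *
        ((p : ℝ) / ((p : ℝ) + k)) ^ (i + a) - 1| ≤ C / p := by
  obtain ⟨C, hC, p₀, h⟩ := exists_abs_prod_sub_one_le_div (Finset.Icc 1 (i + a))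
    (fun j p (k : ℕ) => ((p : ℝ) + (d - i + j) + k) / (p + (d - i + j)) * (p / (p + k)))
    fun j _ => exists_abs_shifted_ratio_sub_one_le_div (d - i + j)
  refine ⟨C, hC, p₀, fun p hp k => ?_⟩
  convert h p hp k using 3
  rw [Finset.prod_mul_distrib, Finset.prod_const, Nat.card_Icc, Nat.add_sub_cancel]
  congr 1
  refine Finset.prod_congr rfl fun j _ => ?_
  congr 1 <;> ring
end

section
/- (Mini-theorem 1.) In Case 1, if M00 is the median probability model, i.e. p1 ≤ 1/2 and p2 ≤ 1/2, then M00 is optimal: R(00) ≤ R(γ) for every γ ∈ {00, 10, 01, 11}. -/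
/-- Mini-theorem 1: in Case 1, if M00 is the median probability model then it is optimal. -/
theorem stmt_8
    (r12 r1y r2y p00 p10 p01 p11 : ℝ)
    (h12 : |r12| < 1) (h1y : r1y ≠ 0) (h2y : r2y ≠ 0)
    (hpd : 0 < 1 - r12 ^ 2 - r1y ^ 2 - r2y ^ 2 + 2 * r12 * r1y * r2y)
    (hp00 : 0 ≤ p00) (hp10 : 0 ≤ p10) (hp01 : 0 ≤ p01) (hp11 : 0 ≤ p11)
    (hsum : p00 + p10 + p01 + p11 = 1)
    (a b c d : ℝ)
    (ha : a = r1y) (hb : b = r12 * r2y)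
    (hc : c = Real.sqrt (1 - r12 ^ 2) * r2y)
    (hd : d = (r2y - r12 * r1y) / Real.sqrt (1 - r12 ^ 2))
    (α : Bool × Bool → ℝ × ℝ)
    (hα00 : α (false, false) = (0, 0))
    (hα10 : α (true, false) = (a, 0))
    (hα01 : α (false, true) = (b, c))
    (hα11 : α (true, true) = (a, d))
    (abar : ℝ × ℝ)
    (habar : abar = p10 • α (true, false) + p01 • α (false, true) + p11 • α (true, true))
    (R : Bool × Bool → ℝ)
    (hR : ∀ γ, R γ = ((α γ).1 - abar.1) ^ 2 + ((α γ).2 - abar.2) ^ 2)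
    (A1 A2 : ℝ) (hA1 : A1 = r12 * r1y / r2y) (hA2 : A2 = r12 * r2y / r1y)
    (hcase1 : A1 < 0)
    (hmed1 : p10 + p11 ≤ 1 / 2) (hmed2 : p01 + p11 ≤ 1 / 2) :
    ∀ γ, R (false, false) ≤ R γ := by
  have hs : r12 * r1y * r2y < 0 := by
    have h : r12 * r1y * r2y = A1 * r2y ^ 2 := by rw [hA1]; field_simp
    rw [h]
    exact mul_neg_of_neg_of_pos hcase1 (by positivity)
  have hpos : 0 < 1 - r12 ^ 2 := sub_pos.2 ((sq_lt_one_iff_abs_lt_one r12).2 h12)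
  have htpos := Real.sqrt_pos.2 hpos
  have htsq := Real.sq_sqrt hpos.le
  set t := Real.sqrt (1 - r12 ^ 2)
  have hdt : d * t = r2y - r12 * r1y := by rw [hd]; field_simp
  have hab : a * b = r12 * r1y * r2y := by rw [ha, hb]; ring
  have hcd : c * d = r2y ^ 2 - r12 * r1y * r2y := by
    rw [hc]; linear_combination r2y * hdt
  have hbc : b ^ 2 + c ^ 2 = r2y ^ 2 := by
    rw [hb, hc]; linear_combination r2y ^ 2 * htsq
  have hd2 : r2y ^ 2 ≤ d ^ 2 := by
    have h : d ^ 2 * (1 - r12 ^ 2) = (r2y - r12 * r1y) ^ 2 := by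
      rw [← htsq, ← hdt]; ring
    nlinarith [mul_nonneg (sq_nonneg d) (sq_nonneg r12), sq_nonneg (r12 * r1y)]
  rintro ⟨_ | _, _ | _⟩ <;> simp only [hR, habar, hα00, hα10, hα01, hα11, Prod.fst_add,
    Prod.snd_add, Prod.smul_fst, Prod.smul_snd, smul_eq_mul]
  · exact le_rfl
  · have h1 := mul_nonneg (sub_nonneg.2 hmed2) (sq_nonneg r2y)
    have h2 := mul_nonneg hp10 (neg_pos.2 hs).le
    linear_combination 2 * h1 + 2 * h2 + 2 * p10 * hab + (2 * p01 - 1) * hbc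
      + 2 * p11 * hab + 2 * p11 * hcd
  · have h1 := mul_nonneg (sub_nonneg.2 hmed1) (sq_nonneg a)
    have h2 := mul_nonneg hp01 (neg_pos.2 hs).le
    linear_combination 2 * h1 + 2 * h2 + 2 * p01 * hab
  · have h1 := mul_nonneg (sub_nonneg.2 hmed1) (sq_nonneg a)
    have h2 := mul_nonneg (sub_nonneg.2 hmed2) (sq_nonneg d)
    have h3 := mul_nonneg hp01 (sub_nonneg.2 hd2)
    linear_combination 2 * h1 + 2 * h2 + 2 * h3 + 2 * p01 * hab + 2 * p01 * hcd
end

section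
/- (Mini-theorem 2.) In Case 2, if M11 is the median probability model, i.e. p1 ≥ 1/2 and p2 ≥ 1/2, then M11 is optimal: R(11) ≤ R(γ) for every γ ∈ {00, 10, 01, 11}. -/
/-- Mini-theorem 2: in Case 2, if M11 is the median probability model then it is optimal. -/
theorem stmt_9
    (r12 r1y r2y p00 p10 p01 p11 : ℝ)
    (h12 : |r12| < 1) (h1y : r1y ≠ 0) (h2y : r2y ≠ 0)
    (hpd : 0 < 1 - r12 ^ 2 - r1y ^ 2 - r2y ^ 2 + 2 * r12 * r1y * r2y)
    (hp00 : 0 ≤ p00) (hp10 : 0 ≤ p10) (hp01 : 0 ≤ p01) (hp11 : 0 ≤ p11)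
    (hsum : p00 + p10 + p01 + p11 = 1)
    (a b c d : ℝ)
    (ha : a = r1y) (hb : b = r12 * r2y)
    (hc : c = Real.sqrt (1 - r12 ^ 2) * r2y)
    (hd : d = (r2y - r12 * r1y) / Real.sqrt (1 - r12 ^ 2))
    (α : Bool × Bool → ℝ × ℝ)
    (hα00 : α (false, false) = (0, 0))
    (hα10 : α (true, false) = (a, 0))
    (hα01 : α (false, true) = (b, c))
    (hα11 : α (true, true) = (a, d))
    (abar : ℝ × ℝ)
    (habar : abar = p10 • α (true, false) + p01 • α (false, true) + p11 • α (true, true))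
    (R : Bool × Bool → ℝ)
    (hR : ∀ γ, R γ = ((α γ).1 - abar.1) ^ 2 + ((α γ).2 - abar.2) ^ 2)
    (A1 A2 : ℝ) (hA1 : A1 = r12 * r1y / r2y) (hA2 : A2 = r12 * r2y / r1y)
    (hcase2 : 0 < A1 ∧ A1 < 1 ∧ 0 < A2 ∧ A2 < 1)
    (hmed1 : 1 / 2 ≤ p10 + p11) (hmed2 : 1 / 2 ≤ p01 + p11) :
    ∀ γ, R (true, true) ≤ R γ := by
  obtain ⟨hA1_pos, hA1_lt, -, hA2_lt⟩ := hcase2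
  set s := Real.sqrt (1 - r12 ^ 2)
  have hr : 0 < 1 - r12 ^ 2 := by nlinarith [abs_lt.mp h12]
  have hs_pos : 0 < s := Real.sqrt_pos.mpr hr
  have hs_sq : s ^ 2 = 1 - r12 ^ 2 := Real.sq_sqrt hr.le
  have hz : 0 < r2y ^ 2 := by positivity
  have hP1 : r12 * r1y * r2y = A1 * r2y ^ 2 := by rw [hA1]; field_simp
  have hP2 : r12 * r2y = A2 * r1y := by rw [hA2]; field_simp
  have hP_pos : 0 < r12 * r1y * r2y := by rw [hP1]; positivity
  have hP_lt : r12 * r1y * r2y < r2y ^ 2 := by rw [hP1]; nlinarith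
  have hrz : (r12 * r2y) ^ 2 < r12 * r1y * r2y := by
    have h1 : (r12 * r2y) ^ 2 = A2 * (r12 * r1y * r2y) := by
      linear_combination (r12 * r2y) * hP2
    rw [h1]; nlinarith
  have hsd : s * d = r2y - r12 * r1y := by rw [hd]; field_simp
  have hcd : c * d = r2y ^ 2 - r12 * r1y * r2y := by
    rw [hc]; linear_combination r2y * hsd
  have hbc : b ^ 2 + c ^ 2 = r2y ^ 2 := by
    rw [hb, hc]; linear_combination r2y ^ 2 * hs_sq
  have hab : a * b = r12 * r1y * r2y := by rw [ha, hb]; ring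
  have hd_le : d ^ 2 ≤ c * d := by
    have h1 : (s * r2y) ^ 2 * (c * d - d ^ 2)
        = (r2y ^ 2 - r12 * r1y * r2y) * (r12 * r1y * r2y - (r12 * r2y) ^ 2) := by
      rw [hcd]
      linear_combination r2y ^ 2 * (r2y ^ 2 - r12 * r1y * r2y) * hs_sq
        - r2y ^ 2 * (s * d + (r2y - r12 * r1y)) * hsd
    have h2 := mul_pos (sub_pos.mpr hP_lt) (sub_pos.mpr hrz)
    rw [← h1] at h2
    have h3 : 0 < c * d - d ^ 2 := pos_of_mul_pos_right h2 (sq_nonneg _)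
    linarith
  have hperp : b * (b - a) + c * (c - d) = 0 := by linear_combination hbc - hab - hcd
  have hp00' : p00 = 1 - p10 - p01 - p11 := by linarith
  rintro ⟨_ | _, _ | _⟩ <;> rw [← sub_nonneg] <;>
    simp only [hR, habar, hα00, hα10, hα01, hα11, Prod.fst_add, Prod.snd_add, Prod.smul_fst,
      Prod.smul_snd, smul_eq_mul]
  · have key : 0 ≤ (2 * p11 - 1) * (a ^ 2 + d ^ 2) + 2 * p10 * a ^ 2
        + 2 * p01 * (b ^ 2 + c ^ 2) := by
      have hle : d ^ 2 ≤ b ^ 2 + c ^ 2 := by linarith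
      nlinarith [mul_nonneg hp01 (sub_nonneg.mpr hle),
        mul_nonneg (by linarith : 0 ≤ 2 * (p10 + p11) - 1) (sq_nonneg a),
        mul_nonneg (by linarith : 0 ≤ 2 * (p01 + p11) - 1) (sq_nonneg d)]
    linear_combination key + 2 * p01 * hperp
  · have key : 0 ≤ ((b - a) ^ 2 + (c - d) ^ 2) * (1 - 2 * p00 - 2 * p01)
        + 2 * p10 * (c * d - d ^ 2) :=
      add_nonneg (mul_nonneg (by positivity) (by linarith))
        (mul_nonneg (by positivity) (by linarith))
    rw [hp00'] at key
    linear_combination key - 2 * (1 - p10 - p01 - p11) * hperp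
  · have key : 0 ≤ d ^ 2 * (2 * (p01 + p11) - 1) + 2 * p01 * (c * d - d ^ 2) :=
      add_nonneg (mul_nonneg (by positivity) (by linarith))
        (mul_nonneg (by positivity) (by linarith))
    linear_combination key
  · simp
end

section
/- (Mini-theorem 3.) In Case 1 and in Case 3, if at most one variable has posterior inclusion probability larger than 1/2 (i.e. p1 ≤ 1/2 or p2 ≤ 1/2), then M11 cannot be optimal: there exists γ ∈ {00, 10, 01} with R(γ) ≤ R(11). -/
/-- The contradiction behind the mini-theorem: `hD` and `hE` express that the full model has
strictly smaller risk than the models omitting the second and the first variable. -/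
theorem half_lt_inclusion_of_risk_lt {A B p q t : ℝ} (hp : 0 ≤ p) (hq : 0 ≤ q)
    (hAB : 0 ≤ A * B) (hAB1 : A * B < 1)
    (hcase : A < 0 ∨ (0 < A ∧ A < 1 ∧ 1 < B))
    (hD : (1 - 2 * t) * (1 - A) ^ 2 < 2 * q * ((1 - A * B) * (1 - A)))
    (hE : (1 - 2 * t) * (1 - B) ^ 2 < 2 * p * ((1 - A * B) * (1 - B))) :
    1 / 2 < p + t ∧ 1 / 2 < q + t := by
  have hA : 0 < 1 - A := by rcases hcase with h | h <;> linarith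
  have hD' : (1 - 2 * t) * (1 - A) < 2 * q * (1 - A * B) := by
    refine lt_of_mul_lt_mul_right ?_ hA.le
    linarith
  have hle : 0 ≤ -A * (1 - B) := by
    rcases hcase with h | ⟨h, -, h'⟩
    · have : B ≤ 0 := by nlinarith
      nlinarith
    · nlinarith
  refine ⟨?_, ?_⟩
  · rcases hcase with h | ⟨-, -, h⟩
    · have hB0 : B ≤ 0 := by nlinarith
      have hB : 0 < 1 - B := by linarith
      have hE' : (1 - 2 * t) * (1 - B) < 2 * p * (1 - A * B) := by
        refine lt_of_mul_lt_mul_right ?_ hB.le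
        linarith
      have hle' : 0 ≤ -B * (1 - A) := mul_nonneg (by linarith) hA.le
      have := mul_nonneg hp hle'
      have : 0 < (2 * (p + t) - 1) * (1 - B) := by linarith
      have := pos_of_mul_pos_left this hB.le
      linarith
    · have h1 : 0 ≤ p * ((1 - A * B) * (B - 1)) :=
        mul_nonneg hp (mul_nonneg (by linarith) (by linarith))
      have h2 : (1 - 2 * t) * (1 - B) ^ 2 < 0 := by linarith
      have := neg_of_mul_neg_left h2 (sq_nonneg _)
      linarith
  · have := mul_nonneg hq hle
    have : 0 < (2 * (q + t) - 1) * (1 - A) := by linarith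
    have := pos_of_mul_pos_left this hA.le
    linarith

/-- Mini-theorem 3: in Case 1 and Case 3, if at most one variable has posterior inclusion probability larger than 1/2, M11 cannot be optimal. -/
theorem stmt_10
    (r12 r1y r2y p00 p10 p01 p11 : ℝ)
    (h12 : |r12| < 1) (h1y : r1y ≠ 0) (h2y : r2y ≠ 0)
    (hpd : 0 < 1 - r12 ^ 2 - r1y ^ 2 - r2y ^ 2 + 2 * r12 * r1y * r2y)
    (hp00 : 0 ≤ p00) (hp10 : 0 ≤ p10) (hp01 : 0 ≤ p01) (hp11 : 0 ≤ p11)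
    (hsum : p00 + p10 + p01 + p11 = 1)
    (a b c d : ℝ)
    (ha : a = r1y) (hb : b = r12 * r2y)
    (hc : c = Real.sqrt (1 - r12 ^ 2) * r2y)
    (hd : d = (r2y - r12 * r1y) / Real.sqrt (1 - r12 ^ 2))
    (α : Bool × Bool → ℝ × ℝ)
    (hα00 : α (false, false) = (0, 0))
    (hα10 : α (true, false) = (a, 0))
    (hα01 : α (false, true) = (b, c))
    (hα11 : α (true, true) = (a, d))
    (abar : ℝ × ℝ)
    (habar : abar = p10 • α (true, false) + p01 • α (false, true) + p11 • α (true, true))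
    (R : Bool × Bool → ℝ)
    (hR : ∀ γ, R γ = ((α γ).1 - abar.1) ^ 2 + ((α γ).2 - abar.2) ^ 2)
    (A1 A2 : ℝ) (hA1 : A1 = r12 * r1y / r2y) (hA2 : A2 = r12 * r2y / r1y)
    (hcase : A1 < 0 ∨ (0 < A1 ∧ A1 < 1 ∧ 1 < A2))
    (hmed : p10 + p11 ≤ 1 / 2 ∨ p01 + p11 ≤ 1 / 2) :
    ∃ γ : Bool × Bool, (γ = (false, false) ∨ γ = (true, false) ∨ γ = (false, true)) ∧ R γ ≤ R (true, true) := by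
  by_contra hcon
  push Not at hcon
  have h10 := hcon (true, false) (by simp)
  have h01 := hcon (false, true) (by simp)
  rw [hR, hR, habar, hα10, hα01, hα11] at h10 h01
  simp only [Prod.fst_add, Prod.snd_add, Prod.smul_fst, Prod.smul_snd, smul_eq_mul] at h10 h01
  have hs2 : 0 < 1 - r12 ^ 2 := by
    have := (sq_lt_one_iff_abs_lt_one r12).2 h12
    linarith
  set s := Real.sqrt (1 - r12 ^ 2) with hs
  have hspos : 0 < s := Real.sqrt_pos.2 hs2
  have hss : s ^ 2 = 1 - r12 ^ 2 := Real.sq_sqrt hs2.le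
  have hx : r12 * r1y = A1 * r2y := by rw [hA1]; field_simp
  have hy : r12 * r2y = A2 * r1y := by rw [hA2]; field_simp
  have hr : A1 * A2 = r12 ^ 2 := by rw [hA1, hA2]; field_simp
  have hds : s * d = r2y * (1 - A1) := by
    rw [hd, mul_div_cancel₀ _ hspos.ne']; linarith
  have hab : a - b = r1y * (1 - A2) := by rw [ha, hb]; linarith
  have hdc : s * (d - c) = -r12 * (r1y * (1 - A2)) := by
    rw [hc, mul_sub, hds]
    linear_combination (-r2y) * hss + r12 * hy + hx
  have hcd : d * c = r2y ^ 2 * (1 - A1) := by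
    rw [hc]; linear_combination r2y * hds
  have hd2 : s ^ 2 * d ^ 2 = r2y ^ 2 * (1 - A1) ^ 2 := by
    linear_combination (s * d + r2y * (1 - A1)) * hds
  have hv2 : s ^ 2 * ((a - b) ^ 2 + (d - c) ^ 2) = r1y ^ 2 * (1 - A2) ^ 2 := by
    have h : s ^ 2 * (d - c) ^ 2 = r12 ^ 2 * (r1y * (1 - A2)) ^ 2 := by
      rw [← mul_pow, hdc]; ring
    rw [mul_add, h, hab, hss]; ring
  have horth : b * (a - b) + c * (d - c) = 0 := by
    rw [hab, hb]; linear_combination r2y * hdc + (d - c) * hc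
  have hD : (1 - 2 * p11) * d ^ 2 < 2 * p01 * (d * c) := by linarith
  have hE : (1 - 2 * p11) * ((a - b) ^ 2 + (d - c) ^ 2) < 2 * p10 * (a * (a - b)) := by
    have h : b * (a - b) = -(c * (d - c)) := by linarith
    have h' : p01 * (b * (a - b)) = -(p01 * (c * (d - c))) := by rw [h]; ring
    have h'' : p11 * (b * (a - b)) = -(p11 * (c * (d - c))) := by rw [h]; ring
    linarith
  have hsq : 0 < s ^ 2 := by positivity
  have hD' : (1 - 2 * p11) * (1 - A1) ^ 2 < 2 * p01 * ((1 - A1 * A2) * (1 - A1)) := by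
    have h := mul_lt_mul_of_pos_left hD hsq
    refine lt_of_mul_lt_mul_left ?_ (sq_nonneg r2y)
    rw [hr, ← hss]
    calc _ = s ^ 2 * ((1 - 2 * p11) * d ^ 2) := by linear_combination (-(1 - 2 * p11)) * hd2
      _ < _ := h
      _ = _ := by rw [hcd]; ring
  have hE' : (1 - 2 * p11) * (1 - A2) ^ 2 < 2 * p10 * ((1 - A1 * A2) * (1 - A2)) := by
    have h := mul_lt_mul_of_pos_left hE hsq
    refine lt_of_mul_lt_mul_left ?_ (sq_nonneg r1y)
    rw [hr, ← hss]
    calc _ = s ^ 2 * ((1 - 2 * p11) * ((a - b) ^ 2 + (d - c) ^ 2)) := by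
          linear_combination (-(1 - 2 * p11)) * hv2
      _ < _ := h
      _ = _ := by rw [hab, ha]; ring
  obtain ⟨h1, h2⟩ := half_lt_inclusion_of_risk_lt hp10 hp01 (hr ▸ sq_nonneg r12)
    (by linarith) hcase hD' hE'
  rcases hmed with h | h <;> linarith
end

section
/- (Mini-theorem 4.) In Case 2 and in Case 3, if at least one variable has posterior inclusion probability larger than 1/2 (i.e. p1 > 1/2 or p2 > 1/2), then M00 cannot be optimal: there exists γ ∈ {10, 01, 11} with R(γ) < R(00). -/
/-- Mini-theorem 4: in Case 2 and Case 3, if at least one variable has posterior inclusion probability larger than 1/2, M00 cannot be optimal. -/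
theorem stmt_11
    (r12 r1y r2y p00 p10 p01 p11 : ℝ)
    (h12 : |r12| < 1) (h1y : r1y ≠ 0) (h2y : r2y ≠ 0)
    (hpd : 0 < 1 - r12 ^ 2 - r1y ^ 2 - r2y ^ 2 + 2 * r12 * r1y * r2y)
    (hp00 : 0 ≤ p00) (hp10 : 0 ≤ p10) (hp01 : 0 ≤ p01) (hp11 : 0 ≤ p11)
    (hsum : p00 + p10 + p01 + p11 = 1)
    (a b c d : ℝ)
    (ha : a = r1y) (hb : b = r12 * r2y)
    (hc : c = Real.sqrt (1 - r12 ^ 2) * r2y)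
    (hd : d = (r2y - r12 * r1y) / Real.sqrt (1 - r12 ^ 2))
    (α : Bool × Bool → ℝ × ℝ)
    (hα00 : α (false, false) = (0, 0))
    (hα10 : α (true, false) = (a, 0))
    (hα01 : α (false, true) = (b, c))
    (hα11 : α (true, true) = (a, d))
    (abar : ℝ × ℝ)
    (habar : abar = p10 • α (true, false) + p01 • α (false, true) + p11 • α (true, true))
    (R : Bool × Bool → ℝ)
    (hR : ∀ γ, R γ = ((α γ).1 - abar.1) ^ 2 + ((α γ).2 - abar.2) ^ 2)
    (A1 A2 : ℝ) (hA1 : A1 = r12 * r1y / r2y) (hA2 : A2 = r12 * r2y / r1y)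
    (hcase : (0 < A1 ∧ A1 < 1 ∧ 0 < A2 ∧ A2 < 1) ∨ (0 < A1 ∧ A1 < 1 ∧ 1 < A2))
    (hmed : 1 / 2 < p10 + p11 ∨ 1 / 2 < p01 + p11) :
    ∃ γ : Bool × Bool, (γ = (true, false) ∨ γ = (false, true) ∨ γ = (true, true)) ∧ R γ < R (false, false) := by
  have hA1pos : 0 < A1 := by rcases hcase with h | h <;> exact h.1
  have hab : 0 < r1y * (r12 * r2y) := by
    have h : r1y * (r12 * r2y) = A1 * r2y ^ 2 := by rw [hA1]; field_simp
    rw [h]; positivity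
  have ha2 : 0 < r1y ^ 2 := by positivity
  have hb2 : 0 < r2y ^ 2 := by positivity
  have hs : 0 < 1 - r12 ^ 2 := by
    have := (sq_lt_one_iff_abs_lt_one r12).2 h12
    linarith
  have hcc : c ^ 2 = (1 - r12 ^ 2) * r2y ^ 2 := by rw [hc, mul_pow, Real.sq_sqrt hs.le]
  have hcd : c * d = r2y * (r2y - r12 * r1y) := by
    have := (Real.sqrt_pos.2 hs).ne'
    rw [hc, hd]; field_simp
  rcases hmed with h | h
  · refine ⟨(true, false), by simp, ?_⟩
    rw [hR, hR, habar, hα00, hα10, hα01, hα11]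
    simp only [Prod.fst_add, Prod.snd_add, Prod.smul_fst, Prod.smul_snd, smul_eq_mul, ha, hb]
    have h1 := mul_pos (sub_pos.2 h) ha2
    have h2 := mul_nonneg hp01 hab.le
    linear_combination 2 * h1 + 2 * h2
  · refine ⟨(false, true), by simp, ?_⟩
    rw [hR, hR, habar, hα00, hα10, hα01, hα11]
    simp only [Prod.fst_add, Prod.snd_add, Prod.smul_fst, Prod.smul_snd, smul_eq_mul, ha, hb]
    have h1 := mul_pos (sub_pos.2 h) hb2
    have h2 := mul_nonneg hp10 hab.le
    linear_combination 2 * h1 + 2 * h2 + (1 - 2 * p01) * hcc - 2 * p11 * hcd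
end

section
/- (Mini-theorem 5.) In Case 1 and in Case 2: if p00 > 1/2 then M00 is optimal (R(00) ≤ R(γ) for all γ), and if p11 > 1/2 then M11 is optimal (R(11) ≤ R(γ) for all γ). -/
/-- If `(a, 0)` and `(b, c)` lie on the circle with diameter `(a, d)` and their inner product is at
most each of their squared norms, then among the four points `0`, `(a, 0)`, `(b, c)`, `(a, d)` one
carrying weight at least `1/2`, if it is `0` or `(a, d)`, is nearest to their weighted mean. -/
theorem endpoint_nearest_weighted_mean {a b c d p00 p10 p01 p11 x y : ℝ}
    (hp10 : 0 ≤ p10) (hp01 : 0 ≤ p01) (hsum : p00 + p10 + p01 + p11 = 1)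
    (hproj : a * b + c * d = b ^ 2 + c ^ 2) (h1 : a * b ≤ a ^ 2) (h2 : a * b ≤ b ^ 2 + c ^ 2)
    (hx : x = p10 * a + p01 * b + p11 * a) (hy : y = p01 * c + p11 * d) :
    (1 / 2 ≤ p00 → x ^ 2 + y ^ 2 ≤ (a - x) ^ 2 + y ^ 2 ∧
      x ^ 2 + y ^ 2 ≤ (b - x) ^ 2 + (c - y) ^ 2 ∧ x ^ 2 + y ^ 2 ≤ (a - x) ^ 2 + (d - y) ^ 2) ∧
    (1 / 2 ≤ p11 → (a - x) ^ 2 + (d - y) ^ 2 ≤ x ^ 2 + y ^ 2 ∧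
      (a - x) ^ 2 + (d - y) ^ 2 ≤ (a - x) ^ 2 + y ^ 2 ∧
      (a - x) ^ 2 + (d - y) ^ 2 ≤ (b - x) ^ 2 + (c - y) ^ 2) := by
  have hA : 0 ≤ a ^ 2 := sq_nonneg a
  have hB : 0 ≤ b ^ 2 + c ^ 2 := by positivity
  have hD : 0 ≤ d ^ 2 := sq_nonneg d
  have hWB : b ^ 2 + c ^ 2 ≤ a ^ 2 + d ^ 2 := by
    nlinarith [sq_nonneg (a - b), sq_nonneg (d - c)]
  -- inner products of the mean with the three nonzero points
  have iu : a * x = p10 * a ^ 2 + p01 * (a * b) + p11 * a ^ 2 := by rw [hx]; ring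
  have iv : b * x + c * y = p10 * (a * b) + p01 * (b ^ 2 + c ^ 2) + p11 * (b ^ 2 + c ^ 2) := by
    rw [hx, hy]; linear_combination p11 * hproj
  have iw : a * x + d * y = p10 * a ^ 2 + p01 * (b ^ 2 + c ^ 2) + p11 * (a ^ 2 + d ^ 2) := by
    rw [hx, hy]; linear_combination p01 * hproj
  have m1 := mul_le_mul_of_nonneg_left h1 hp01
  have m2 := mul_le_mul_of_nonneg_left h2 hp10
  have m3 := mul_le_mul_of_nonneg_left h2 hp01
  have m4 := mul_le_mul_of_nonneg_left h1 hp10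
  have m5 := mul_le_mul_of_nonneg_left hWB hp01
  have m6 := mul_nonneg hp10 hD
  have m7 := mul_nonneg hp10 hA
  have m8 := mul_nonneg hp01 hB
  obtain rfl : p00 = 1 - p10 - p01 - p11 := by linarith
  refine ⟨fun h => ⟨?_, ?_, ?_⟩, fun h => ⟨?_, ?_, ?_⟩⟩
  · linarith [mul_le_mul_of_nonneg_right h hA]
  · linarith [mul_le_mul_of_nonneg_right h hB]
  · linarith [mul_le_mul_of_nonneg_right h (add_nonneg hA hD)]
  · linarith [mul_le_mul_of_nonneg_right h (add_nonneg hA hD)]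
  · linarith [mul_le_mul_of_nonneg_right h hD]
  · linarith [mul_le_mul_of_nonneg_right h (sub_nonneg.2 hWB)]

/-- Mini-theorem 5: in Cases 1 and 2, if M00 (resp. M11) has posterior probability larger than 1/2 then it is optimal. -/
theorem stmt_12
    (r12 r1y r2y p00 p10 p01 p11 : ℝ)
    (h12 : |r12| < 1) (h1y : r1y ≠ 0) (h2y : r2y ≠ 0)
    (hpd : 0 < 1 - r12 ^ 2 - r1y ^ 2 - r2y ^ 2 + 2 * r12 * r1y * r2y)
    (hp00 : 0 ≤ p00) (hp10 : 0 ≤ p10) (hp01 : 0 ≤ p01) (hp11 : 0 ≤ p11)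
    (hsum : p00 + p10 + p01 + p11 = 1)
    (a b c d : ℝ)
    (ha : a = r1y) (hb : b = r12 * r2y)
    (hc : c = Real.sqrt (1 - r12 ^ 2) * r2y)
    (hd : d = (r2y - r12 * r1y) / Real.sqrt (1 - r12 ^ 2))
    (α : Bool × Bool → ℝ × ℝ)
    (hα00 : α (false, false) = (0, 0))
    (hα10 : α (true, false) = (a, 0))
    (hα01 : α (false, true) = (b, c))
    (hα11 : α (true, true) = (a, d))
    (abar : ℝ × ℝ)
    (habar : abar = p10 • α (true, false) + p01 • α (false, true) + p11 • α (true, true))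
    (R : Bool × Bool → ℝ)
    (hR : ∀ γ, R γ = ((α γ).1 - abar.1) ^ 2 + ((α γ).2 - abar.2) ^ 2)
    (A1 A2 : ℝ) (hA1 : A1 = r12 * r1y / r2y) (hA2 : A2 = r12 * r2y / r1y)
    (hcase : A1 < 0 ∨ (0 < A1 ∧ A1 < 1 ∧ 0 < A2 ∧ A2 < 1)) :
    (1 / 2 < p00 → ∀ γ, R (false, false) ≤ R γ) ∧ (1 / 2 < p11 → ∀ γ, R (true, true) ≤ R γ) := by
  have hs : 0 < 1 - r12 ^ 2 := sub_pos.2 ((sq_lt_one_iff_abs_lt_one r12).2 h12)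
  have hsq : Real.sqrt (1 - r12 ^ 2) ^ 2 = 1 - r12 ^ 2 := Real.sq_sqrt hs.le
  have hs0 : Real.sqrt (1 - r12 ^ 2) ≠ 0 := (Real.sqrt_pos.2 hs).ne'
  have hB : b ^ 2 + c ^ 2 = r2y ^ 2 := by
    rw [hb, hc]; linear_combination r2y ^ 2 * hsq
  have hcd : c * d = r2y * (r2y - r12 * r1y) := by
    rw [hc, hd]; field_simp
  have hproj : a * b + c * d = b ^ 2 + c ^ 2 := by
    rw [hB, hcd, ha, hb]; ring
  have ht1 : a * b = A1 * r2y ^ 2 := by rw [ha, hb, hA1]; field_simp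
  have ht2 : a * b = A2 * a ^ 2 := by rw [ha, hb, hA2]; field_simp
  have h1 : a * b ≤ a ^ 2 := by
    rcases hcase with h | ⟨-, -, -, h⟩
    · nlinarith [mul_nonneg (neg_nonneg.2 h.le) (sq_nonneg r2y), sq_nonneg a]
    · nlinarith [mul_nonneg (sub_nonneg.2 h.le) (sq_nonneg a)]
  have h2 : a * b ≤ b ^ 2 + c ^ 2 := by
    have h : A1 ≤ 1 := by rcases hcase with h | ⟨-, h, -, -⟩ <;> linarith
    rw [hB, ht1]
    exact mul_le_of_le_one_left (sq_nonneg r2y) h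
  have hx : abar.1 = p10 * a + p01 * b + p11 * a := by simp [habar, hα10, hα01, hα11]
  have hy : abar.2 = p01 * c + p11 * d := by simp [habar, hα10, hα01, hα11]
  obtain ⟨H0, H1⟩ := endpoint_nearest_weighted_mean hp10 hp01 hsum hproj h1 h2 hx hy
  constructor
  · intro h
    obtain ⟨hu, hv, hw⟩ := H0 h.le
    rintro ⟨_ | _, _ | _⟩ <;> simp only [hR, hα00, hα10, hα01, hα11] <;> linarith
  · intro h
    obtain ⟨ho, hu, hv⟩ := H1 h.le
    rintro ⟨_ | _, _ | _⟩ <;> simp only [hR, hα00, hα10, hα01, hα11] <;> linarith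
end

section
/- (Mini-theorem 6.) In any of Case 1, Case 2, or Case 3: if p00 > 1/2 then M11 cannot be optimal (there exists γ ≠ 11 with R(γ) < R(11)), and if p11 > 1/2 then M00 cannot be optimal (there exists γ ≠ 00 with R(γ) < R(00)). -/
/-- Mini-theorem 6: in any of Cases 1-3, if M00 (resp. M11) has posterior probability larger than 1/2, the other extreme model cannot be optimal. -/
theorem stmt_13
    (r12 r1y r2y p00 p10 p01 p11 : ℝ)
    (h12 : |r12| < 1) (h1y : r1y ≠ 0) (h2y : r2y ≠ 0)
    (hpd : 0 < 1 - r12 ^ 2 - r1y ^ 2 - r2y ^ 2 + 2 * r12 * r1y * r2y)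
    (hp00 : 0 ≤ p00) (hp10 : 0 ≤ p10) (hp01 : 0 ≤ p01) (hp11 : 0 ≤ p11)
    (hsum : p00 + p10 + p01 + p11 = 1)
    (a b c d : ℝ)
    (ha : a = r1y) (hb : b = r12 * r2y)
    (hc : c = Real.sqrt (1 - r12 ^ 2) * r2y)
    (hd : d = (r2y - r12 * r1y) / Real.sqrt (1 - r12 ^ 2))
    (α : Bool × Bool → ℝ × ℝ)
    (hα00 : α (false, false) = (0, 0))
    (hα10 : α (true, false) = (a, 0))
    (hα01 : α (false, true) = (b, c))
    (hα11 : α (true, true) = (a, d))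
    (abar : ℝ × ℝ)
    (habar : abar = p10 • α (true, false) + p01 • α (false, true) + p11 • α (true, true))
    (R : Bool × Bool → ℝ)
    (hR : ∀ γ, R γ = ((α γ).1 - abar.1) ^ 2 + ((α γ).2 - abar.2) ^ 2)
    (A1 A2 : ℝ) (hA1 : A1 = r12 * r1y / r2y) (hA2 : A2 = r12 * r2y / r1y)
    (hcase : A1 < 0 ∨ (0 < A1 ∧ A1 < 1 ∧ 0 < A2 ∧ A2 < 1) ∨ (0 < A1 ∧ A1 < 1 ∧ 1 < A2)) :
    (1 / 2 < p00 → ∃ γ : Bool × Bool, γ ≠ (true, true) ∧ R γ < R (true, true)) ∧ (1 / 2 < p11 → ∃ γ : Bool × Bool, γ ≠ (false, false) ∧ R γ < R (false, false)) := by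
  have hs2 : 0 < 1 - r12 ^ 2 := by
    have := (sq_lt_one_iff_abs_lt_one r12).2 h12
    linarith
  have hspos : 0 < √(1 - r12 ^ 2) := Real.sqrt_pos.2 hs2
  have hsq : √(1 - r12 ^ 2) ^ 2 = 1 - r12 ^ 2 := Real.sq_sqrt hs2.le
  rw [hα10, hα01, hα11] at habar
  have hR00 := hR (false, false)
  have hR11 := hR (true, true)
  rw [hα00, habar] at hR00
  rw [hα11, habar] at hR11
  simp only [Prod.smul_mk, Prod.mk_add_mk, smul_eq_mul] at hR00 hR11
  generalize √(1 - r12 ^ 2) = s at *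
  have hsd : r2y = r12 * a + s * d := by
    rw [hd, ha]; field_simp; ring
  have hV : 0 < a ^ 2 + d ^ 2 := by rw [ha]; positivity
  have hQV : b * a + c * d = r2y ^ 2 := by
    rw [hb, hc]; linear_combination -r2y * hsd
  -- the points `(a, 0)` and `(b, c)` are orthogonal projections of `(a, d)`
  have hQle : r2y ^ 2 ≤ a ^ 2 + d ^ 2 := by
    have h : a ^ 2 + d ^ 2 - r2y ^ 2 = (r12 * d - s * a) ^ 2 := by
      rw [hsd]; linear_combination (-(a ^ 2 + d ^ 2)) * hsq
    linarith [sq_nonneg (r12 * d - s * a)]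
  have hdiff : R (true, true) - R (false, false) =
      (a ^ 2 + d ^ 2) - 2 * (p10 * a ^ 2 + p01 * r2y ^ 2 + p11 * (a ^ 2 + d ^ 2)) := by
    rw [hR00, hR11]; linear_combination -2 * p01 * hQV
  have hP0 : 0 ≤ p10 * a ^ 2 := by positivity
  have hQ0 : 0 ≤ p01 * r2y ^ 2 := by positivity
  constructor
  · intro h
    refine ⟨(false, false), by decide, ?_⟩
    have hP1 : p10 * a ^ 2 ≤ p10 * (a ^ 2 + d ^ 2) :=
      mul_le_mul_of_nonneg_left (by linarith [sq_nonneg d]) hp10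
    have hQ1 := mul_le_mul_of_nonneg_left hQle hp01
    have hlt : 0 < (1 - 2 * (p10 + p01 + p11)) * (a ^ 2 + d ^ 2) :=
      mul_pos (by linarith) hV
    linarith
  · intro h
    refine ⟨(true, true), by decide, ?_⟩
    have hlt : 0 < (2 * p11 - 1) * (a ^ 2 + d ^ 2) := mul_pos (by linarith) hV
    linarith
end

section
/- (Mini-theorem 7.) In Case 3: if p00 < 1/2 then M00 cannot be optimal (there exists γ ≠ 00 with R(γ) < R(00)), and if p11 < 1/2 then M11 cannot be optimal (there exists γ ≠ 11 with R(γ) < R(11)). -/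
/-- Mini-theorem 7: in Case 3, if M00 (resp. M11) has posterior probability smaller than 1/2 it cannot be optimal. -/
theorem stmt_14
    (r12 r1y r2y p00 p10 p01 p11 : ℝ)
    (h12 : |r12| < 1) (h1y : r1y ≠ 0) (h2y : r2y ≠ 0)
    (hpd : 0 < 1 - r12 ^ 2 - r1y ^ 2 - r2y ^ 2 + 2 * r12 * r1y * r2y)
    (hp00 : 0 ≤ p00) (hp10 : 0 ≤ p10) (hp01 : 0 ≤ p01) (hp11 : 0 ≤ p11)
    (hsum : p00 + p10 + p01 + p11 = 1)
    (a b c d : ℝ)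
    (ha : a = r1y) (hb : b = r12 * r2y)
    (hc : c = Real.sqrt (1 - r12 ^ 2) * r2y)
    (hd : d = (r2y - r12 * r1y) / Real.sqrt (1 - r12 ^ 2))
    (α : Bool × Bool → ℝ × ℝ)
    (hα00 : α (false, false) = (0, 0))
    (hα10 : α (true, false) = (a, 0))
    (hα01 : α (false, true) = (b, c))
    (hα11 : α (true, true) = (a, d))
    (abar : ℝ × ℝ)
    (habar : abar = p10 • α (true, false) + p01 • α (false, true) + p11 • α (true, true))
    (R : Bool × Bool → ℝ)
    (hR : ∀ γ, R γ = ((α γ).1 - abar.1) ^ 2 + ((α γ).2 - abar.2) ^ 2)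
    (A1 A2 : ℝ) (hA1 : A1 = r12 * r1y / r2y) (hA2 : A2 = r12 * r2y / r1y)
    (hcase3 : 0 < A1 ∧ A1 < 1 ∧ 1 < A2) :
    (p00 < 1 / 2 → ∃ γ : Bool × Bool, γ ≠ (false, false) ∧ R γ < R (false, false)) ∧ (p11 < 1 / 2 → ∃ γ : Bool × Bool, γ ≠ (true, true) ∧ R γ < R (true, true)) := by
  obtain ⟨-, -, hA2_gt⟩ := hcase3
  have hs : 0 < 1 - r12 ^ 2 := by nlinarith [abs_lt.mp h12]
  have hsq : Real.sqrt (1 - r12 ^ 2) ^ 2 = 1 - r12 ^ 2 := Real.sq_sqrt hs.le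
  have hsne : Real.sqrt (1 - r12 ^ 2) ≠ 0 := (Real.sqrt_pos.mpr hs).ne'
  have ha2 : 0 < a ^ 2 := by rw [ha]; positivity
  have hab : a ^ 2 < a * b := by
    have h : a * b = A2 * a ^ 2 := by
      rw [ha, hb, hA2]
      field_simp
    nlinarith
  have horth : (b - a) * b + (c - d) * c = 0 := by
    have hcd : d * c = (r2y - r12 * r1y) * r2y := by
      rw [hc, hd]
      field_simp
    have hcc : c ^ 2 = (1 - r12 ^ 2) * r2y ^ 2 := by rw [hc, mul_pow, hsq]
    rw [ha, hb]
    linear_combination hcc - hcd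
  have hedge : 0 < (b - a) ^ 2 + (c - d) ^ 2 := by
    have hne : b - a ≠ 0 := fun h => by
      rw [sub_eq_zero.mp h] at hab
      linarith [sq a]
    positivity
  have hbar1 : abar.1 = p10 * a + p01 * b + p11 * a := by
    simp [habar, hα10, hα01, hα11]
  have hbar2 : abar.2 = p01 * c + p11 * d := by
    simp [habar, hα10, hα01, hα11]
  constructor
  · intro hp
    refine ⟨(true, false), by simp, ?_⟩
    rw [hR, hR, hα10, hα00]
    have hdiff : (a - abar.1) ^ 2 + (0 - abar.2) ^ 2 - ((0 - abar.1) ^ 2 + (0 - abar.2) ^ 2)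
        = -((1 - 2 * p00) * a ^ 2) - 2 * (p01 * (a * b - a ^ 2)) := by
      rw [hbar1]
      linear_combination (-2 * a ^ 2) * hsum
    have h1 : 0 < (1 - 2 * p00) * a ^ 2 := mul_pos (by linarith) ha2
    have h2 : 0 ≤ p01 * (a * b - a ^ 2) := mul_nonneg hp01 (by linarith)
    dsimp only
    linarith
  · intro hp
    refine ⟨(false, true), by simp, ?_⟩
    rw [hR, hR, hα01, hα11]
    have hdiff : (b - abar.1) ^ 2 + (c - abar.2) ^ 2 - ((a - abar.1) ^ 2 + (d - abar.2) ^ 2)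
        = -((1 - 2 * p11) * ((b - a) ^ 2 + (c - d) ^ 2)) - 2 * (p10 * (a * b - a ^ 2)) := by
      rw [hbar1, hbar2]
      linear_combination (2 - 2 * p01 - 2 * p11) * horth
    have h1 : 0 < (1 - 2 * p11) * ((b - a) ^ 2 + (c - d) ^ 2) := mul_pos (by linarith) hedge
    have h2 : 0 ≤ p10 * (a * b - a ^ 2) := mul_nonneg hp10 (by linarith)
    dsimp only
    linarith
end

section
/- Let q ≥ 1, let d₁, …, d_q > 0, z ∈ ℝ^q, and 0 < v₀ < v₁. Let π be a probability mass function on {0,1}^q with marginal inclusion probabilities p_i = Σ_{γ : γᵢ = 1} π(γ). For γ ∈ {0,1}^q define β̂(γ) ∈ ℝ^q by β̂(γ)ᵢ = zᵢ / (dᵢ + γᵢ/v₁ + (1−γᵢ)/v₀), set β̄ = Σ_γ π(γ) β̂(γ), and define R(γ) = Σᵢ dᵢ (β̂(γ)ᵢ − β̄ᵢ)². Then: (i) R(γ) = Σ_{i=1}^q ( 1/(dᵢ + 1/v₁) − 1/(dᵢ + 1/v₀) )² (γᵢ − p_i)² dᵢ zᵢ²; and (ii) any γ* with γ*ᵢ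 = 1 if and only if p_i > 1/2 minimizes R over {0,1}^q. -/
/-- optimality of the median probability model under continuous
Gaussian spike-and-slab priors in an orthogonal design. -/
theorem stmt_16 (q : ℕ) (hq : 1 ≤ q) (d : Fin q → ℝ) (hd : ∀ i, 0 < d i)
    (z : Fin q → ℝ) (v0 v1 : ℝ) (hv0 : 0 < v0) (hv01 : v0 < v1)
    (π : (Fin q → Bool) → ℝ) (hπ0 : ∀ γ, 0 ≤ π γ) (hπ1 : ∑ γ, π γ = 1)
    (p : Fin q → ℝ)
    (hp : ∀ i, p i = ∑ γ ∈ Finset.univ.filter (fun γ : Fin q → Bool => γ i = true), π γ)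
    (βhat : (Fin q → Bool) → Fin q → ℝ)
    (hβhat : ∀ γ i, βhat γ i = z i / (d i + (if γ i then 1 / v1 else 1 / v0)))
    (βbar : Fin q → ℝ) (hβbar : ∀ i, βbar i = ∑ γ, π γ * βhat γ i)
    (R : (Fin q → Bool) → ℝ)
    (hR : ∀ γ, R γ = ∑ i, d i * (βhat γ i - βbar i) ^ 2) :
    (∀ γ, R γ = ∑ i, (1 / (d i + 1 / v1) - 1 / (d i + 1 / v0)) ^ 2 *
        ((if γ i then (1 : ℝ) else 0) - p i) ^ 2 * d i * (z i) ^ 2) ∧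
    (∀ γs : Fin q → Bool, (∀ i, γs i = true ↔ 1 / 2 < p i) → ∀ γ, R γs ≤ R γ) := by
  have hβ : ∀ γ i, βhat γ i = z i * (1 / (d i + 1 / v0)) +
      z i * (1 / (d i + 1 / v1) - 1 / (d i + 1 / v0)) * (if γ i then (1 : ℝ) else 0) := by
    intro γ i
    rw [hβhat]
    split_ifs <;> ring
  have hbar : ∀ i, βbar i = z i * (1 / (d i + 1 / v0)) +
      z i * (1 / (d i + 1 / v1) - 1 / (d i + 1 / v0)) * p i := by
    intro i
    have hp' : p i = ∑ γ, π γ * (if γ i then (1 : ℝ) else 0) := by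
      simp [hp, Finset.sum_filter]
    calc βbar i = ∑ γ, (z i * (1 / (d i + 1 / v0)) * π γ +
          z i * (1 / (d i + 1 / v1) - 1 / (d i + 1 / v0)) *
            (π γ * (if γ i then (1 : ℝ) else 0))) := by
          rw [hβbar]
          refine Finset.sum_congr rfl fun γ _ => ?_
          rw [hβ]
          ring
      _ = _ := by
          rw [Finset.sum_add_distrib, ← Finset.mul_sum, ← Finset.mul_sum, hπ1, ← hp', mul_one]
  have hrisk : ∀ γ, R γ = ∑ i, (1 / (d i + 1 / v1) - 1 / (d i + 1 / v0)) ^ 2 *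
      ((if γ i then (1 : ℝ) else 0) - p i) ^ 2 * d i * (z i) ^ 2 := by
    intro γ
    rw [hR]
    refine Finset.sum_congr rfl fun i _ => ?_
    rw [hβ, hbar]
    ring
  refine ⟨hrisk, fun γs hγs γ => ?_⟩
  rw [hrisk, hrisk]
  refine Finset.sum_le_sum fun i _ => ?_
  have hdi := (hd i).le
  have hsq : ((if γs i then (1 : ℝ) else 0) - p i) ^ 2 ≤
      ((if γ i then (1 : ℝ) else 0) - p i) ^ 2 := by
    have h := hγs i
    by_cases hs : γs i = true <;> by_cases hg : γ i = true <;> simp only [hs, hg, if_true]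
    · exact le_rfl
    · have := h.mp hs
      simp only [Bool.false_eq_true, if_false]
      nlinarith
    · have := not_lt.mp (mt h.mpr hs)
      simp only [Bool.false_eq_true, if_false]
      nlinarith
    · exact le_rfl
  gcongr
end

section
/- Let q ≥ 1, let d₁, …, d_q > 0, and let m ∈ ℝ^q. Let π be a probability mass function on {0,1}^q with marginal inclusion probabilities p_i = Σ_{γ : γᵢ = 1} π(γ). For γ ∈ {0,1}^q define β̂(γ) ∈ ℝ^q by β̂(γ)ᵢ = γᵢ · mᵢ, set β̄ = Σ_γ π(γ) β̂(γ), and define R(γ) = Σᵢ dᵢ (β̂(γ)ᵢ − β̄ᵢ)². Then β̄ᵢ = p_i mᵢ, R(γ) = Σ_{i=1}^q dᵢ mᵢ² (γᵢ − p_i)², and any γ* with γ*ᵢ = 1 if and only if p_i > 1/2 minimizes R over {0,1}^q. -/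
/-- optimality of the median probability model for arbitrary
independent product priors in an orthogonal design, where the model-specific
posterior mean is the coordinate restriction of a single vector `m`. -/
theorem stmt_17 (q : ℕ) (hq : 1 ≤ q) (d : Fin q → ℝ) (hd : ∀ i, 0 < d i)
    (m : Fin q → ℝ)
    (π : (Fin q → Bool) → ℝ) (hπ0 : ∀ γ, 0 ≤ π γ) (hπ1 : ∑ γ, π γ = 1)
    (p : Fin q → ℝ)
    (hp : ∀ i, p i = ∑ γ ∈ Finset.univ.filter (fun γ : Fin q → Bool => γ i = true), π γ)
    (βhat : (Fin q → Bool) → Fin q → ℝ)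
    (hβhat : ∀ γ i, βhat γ i = if γ i then m i else 0)
    (βbar : Fin q → ℝ) (hβbar : ∀ i, βbar i = ∑ γ, π γ * βhat γ i)
    (R : (Fin q → Bool) → ℝ)
    (hR : ∀ γ, R γ = ∑ i, d i * (βhat γ i - βbar i) ^ 2) :
    (∀ i, βbar i = p i * m i) ∧
    (∀ γ, R γ = ∑ i, d i * (m i) ^ 2 * ((if γ i then (1 : ℝ) else 0) - p i) ^ 2) ∧
    (∀ γs : Fin q → Bool, (∀ i, γs i = true ↔ 1 / 2 < p i) → ∀ γ, R γs ≤ R γ) := by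
  have hbar : ∀ i, βbar i = p i * m i := by
    intro i
    rw [hβbar, hp, Finset.sum_filter, Finset.sum_mul]
    refine Finset.sum_congr rfl fun γ _ => ?_
    rw [hβhat]
    split_ifs <;> simp
  have hrisk : ∀ γ, R γ =
      ∑ i, d i * (m i) ^ 2 * ((if γ i then (1 : ℝ) else 0) - p i) ^ 2 := by
    intro γ
    rw [hR]
    refine Finset.sum_congr rfl fun i _ => ?_
    rw [hβhat, hbar]
    split_ifs <;> ring
  refine ⟨hbar, hrisk, fun γs hγs γ => ?_⟩
  rw [hrisk, hrisk]
  refine Finset.sum_le_sum fun i _ => ?_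
  have hdm : 0 ≤ d i * m i ^ 2 := mul_nonneg (hd i).le (sq_nonneg _)
  refine mul_le_mul_of_nonneg_left ?_ hdm
  have hi := hγs i
  by_cases h : 1 / 2 < p i
  · rw [if_pos (hi.2 h)]
    split_ifs <;> nlinarith
  · rw [if_neg fun hs => h (hi.1 hs)]
    split_ifs <;> nlinarith
end
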